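/- arXiv:2605.18694 — 3 statements merged into one kernel-verified Lean document; each statement's English description precedes it below -/
import Mathlib

section
/- Under assumptions (A2)–(A4), for any scalar c > 0 and any t ≥ 1, the AdaGrad-Norm iterates satisfy (γ/2)·E[‖∇f(x_t)‖₂²/(λ + √w_t)] ≤ E[f(x_t) − f(x_{t+1})] + γ·(‖σ‖_p²/c)·(E[‖g_t‖₂²/(λ² + v_t)])^{2/p̄} + γ·(c + γ‖L‖_∞/2)·E[‖g_t‖₂²/(λ² + v_t)], where the proxy stepsize is w_t = v_{t−1} + ‖∇f(x_t)‖₂² + c². -/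
open MeasureTheory Finset

/-- The AdaGrad-Norm accumulator `v_t = ∑_{s=1}^t ‖g_s‖₂²`. -/
noncomputable def adaNormV {Ω : Type} {d : ℕ} (g : ℕ → Ω → EuclideanSpace ℝ (Fin d))
    (t : ℕ) (ω : Ω) : ℝ :=
  ∑ s ∈ Finset.Icc 1 t, ‖g s ω‖ ^ 2

/-- The natural filtration `F_t = σ(g_1, …, g_t)`. -/
noncomputable def natFilt {Ω : Type} [MeasurableSpace Ω] {d : ℕ}
    (g : ℕ → Ω → EuclideanSpace ℝ (Fin d)) (t : ℕ) : MeasurableSpace Ω :=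
  ⨆ s ∈ Finset.Icc 1 t, MeasurableSpace.comap (g s) inferInstance

/-- The `ℓ²` norm is dominated by the `ℓᵖ` norm for `0 < p ≤ 2`. -/
lemma norm_rpow_le_sum_abs_rpow {d : ℕ} {p : ℝ} (hp : 0 < p) (hp2 : p ≤ 2)
    (y : EuclideanSpace ℝ (Fin d)) : ‖y‖ ^ p ≤ ∑ i, |y i| ^ p := by
  rcases (norm_nonneg y).eq_or_lt' with h0 | hpos
  · rw [h0, Real.zero_rpow hp.ne']
    positivity
  have hsplit : ∀ a : ℝ, 0 ≤ a → a ^ 2 = a ^ p * a ^ (2 - p) := fun a ha => by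
    rw [← Real.rpow_add_of_nonneg ha hp.le (by linarith), ← Real.rpow_natCast]
    norm_num
  have hcoord : ∀ i, |y i| ^ 2 ≤ |y i| ^ p * ‖y‖ ^ (2 - p) := fun i => by
    rw [hsplit _ (abs_nonneg _)]
    have hi : |y i| ≤ ‖y‖ := by simpa using PiLp.norm_apply_le y i
    have := Real.rpow_le_rpow (abs_nonneg (y i)) hi (by linarith : 0 ≤ 2 - p)
    gcongr
  have hsum : ‖y‖ ^ p * ‖y‖ ^ (2 - p) ≤ (∑ i, |y i| ^ p) * ‖y‖ ^ (2 - p) := by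
    rw [← hsplit _ hpos.le, EuclideanSpace.norm_sq_eq, sum_mul]
    exact sum_le_sum fun i _ => hcoord i
  exact le_of_mul_le_mul_right hsum (Real.rpow_pos_of_pos hpos _)

lemma abs_sqrt_sub_sqrt_proxy_le {E : Type*} [NormedAddCommGroup E] (G g : E) {V c : ℝ}
    (hV : 0 ≤ V) (hc : 0 ≤ c) :
    |√(V + ‖g‖ ^ 2) - √(V + ‖G‖ ^ 2 + c ^ 2)| ≤ ‖g - G‖ + c := by
  have hg : ‖g‖ ≤ √(V + ‖g‖ ^ 2) := Real.le_sqrt_of_sq_le (by linarith)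
  have hG : ‖G‖ ≤ √(V + ‖G‖ ^ 2 + c ^ 2) := Real.le_sqrt_of_sq_le (by nlinarith)
  have hv := Real.sq_sqrt (by positivity : 0 ≤ V + ‖g‖ ^ 2)
  have hw := Real.sq_sqrt (by positivity : 0 ≤ V + ‖G‖ ^ 2 + c ^ 2)
  have h1 : ‖g‖ ≤ ‖G‖ + ‖g - G‖ := by
    simpa using norm_add_le G (g - G)
  have h2 : ‖G‖ ≤ ‖g‖ + ‖g - G‖ := by
    simpa using norm_sub_le g (g - G)
  have hn := norm_nonneg (g - G)
  have hg0 := norm_nonneg g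
  have hG0 := norm_nonneg G
  rw [abs_le]
  constructor
  · suffices √(V + ‖G‖ ^ 2 + c ^ 2) ≤ √(V + ‖g‖ ^ 2) + (‖g - G‖ + c) by linarith
    refine Real.sqrt_le_iff.2 ⟨by positivity, ?_⟩
    nlinarith [mul_le_mul_of_nonneg_right hg hn, pow_le_pow_left₀ hG0 h2 2,
      mul_nonneg (hg0.trans hg) hc, mul_nonneg hn hc]
  · suffices √(V + ‖g‖ ^ 2) ≤ √(V + ‖G‖ ^ 2 + c ^ 2) + (‖g - G‖ + c) by linarith
    refine Real.sqrt_le_iff.2 ⟨by positivity, ?_⟩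
    nlinarith [mul_le_mul_of_nonneg_right hG hn, pow_le_pow_left₀ hg0 h1 2,
      mul_nonneg (hG0.trans hG) hc, mul_nonneg hn hc]

/-- The error made by replacing the stepsize `1 / (l + √v)` by its proxy `1 / (l + √w)`. -/
lemma inner_div_proxy_sub_le {E : Type*} [NormedAddCommGroup E] [InnerProductSpace ℝ E] (G g : E)
    {V c l : ℝ} (hV : 0 ≤ V) (hc : 0 ≤ c) (hl : 0 < l) :
    inner ℝ G g / (l + √(V + ‖G‖ ^ 2 + c ^ 2)) - inner ℝ G g / (l + √(V + ‖g‖ ^ 2)) ≤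
      ‖G‖ / (l + √(V + ‖G‖ ^ 2 + c ^ 2)) * ‖g - G‖ * (‖g‖ / (l + √(V + ‖g‖ ^ 2))) +
        c * (‖G‖ / (l + √(V + ‖G‖ ^ 2 + c ^ 2)) * (‖g‖ / (l + √(V + ‖g‖ ^ 2)))) := by
  have hdist := abs_sqrt_sub_sqrt_proxy_le G g hV hc
  have hsW := Real.sqrt_nonneg (V + ‖G‖ ^ 2 + c ^ 2)
  have hsD := Real.sqrt_nonneg (V + ‖g‖ ^ 2)
  generalize √(V + ‖G‖ ^ 2 + c ^ 2) = sW at *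
  generalize √(V + ‖g‖ ^ 2) = sD at *
  have hW : 0 < l + sW := by linarith
  have hD : 0 < l + sD := by linarith
  calc inner ℝ G g / (l + sW) - inner ℝ G g / (l + sD)
      = inner ℝ G g * (sD - sW) / ((l + sW) * (l + sD)) := by field_simp; ring
    _ ≤ ‖G‖ * ‖g‖ * (‖g - G‖ + c) / ((l + sW) * (l + sD)) := by
        refine div_le_div_of_nonneg_right ?_ (by positivity)
        calc inner ℝ G g * (sD - sW) ≤ |inner ℝ G g| * |sD - sW| := by
              rw [← abs_mul]; exact le_abs_self _
          _ ≤ _ := mul_le_mul (abs_real_inner_le_norm G g) hdist (abs_nonneg _) (by positivity)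
    _ = _ := by field_simp

section CondExp

variable {Ω : Type*} {m m0 : MeasurableSpace Ω} {μ : Measure Ω} [IsProbabilityMeasure μ]

lemma integrable_of_measurable_of_mem_Icc {b : Ω → ℝ} (hb : Measurable b)
    (hb0 : ∀ ω, 0 ≤ b ω) (hb1 : ∀ ω, b ω ≤ 1) : Integrable b μ :=
  Integrable.of_bound hb.aestronglyMeasurable 1
    (.of_forall fun ω => by rw [Real.norm_of_nonneg (hb0 ω)]; exact hb1 ω)

lemma integral_mul_condExp_of_bound (hm : m ≤ m0) {X Y : Ω → ℝ} (hX : Measurable[m] X)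
    (hXb : ∀ ω, |X ω| ≤ 1) (hY : Integrable Y μ) :
    ∫ ω, X ω * Y ω ∂μ = ∫ ω, X ω * (μ[Y | m]) ω ∂μ := by
  have h := condExp_stronglyMeasurable_mul_of_bound hm hX.stronglyMeasurable hY 1
    (.of_forall hXb)
  calc ∫ ω, X ω * Y ω ∂μ = ∫ ω, (μ[X * Y | m]) ω ∂μ := (integral_condExp hm).symm
    _ = _ := integral_congr_ae h

/-- A Hölder estimate in which only the conditional expectation of the noise `S` is controlled. -/
lemma integral_mul_rpow_mul_le (hm : m ≤ m0) {h S b : Ω → ℝ} {p K : ℝ} (hp1 : 1 < p)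
    (hp2 : p ≤ 2) (hh : Measurable[m] h) (hh0 : ∀ ω, 0 ≤ h ω) (hh1 : ∀ ω, h ω ≤ 1)
    (hS : Measurable S) (hSint : Integrable S μ) (hS0 : ∀ ω, 0 ≤ S ω) (hK : 0 ≤ K)
    (hSK : ∀ᵐ ω ∂μ, (μ[S | m]) ω ≤ K)
    (hb : Measurable b) (hb0 : ∀ ω, 0 ≤ b ω) (hb1 : ∀ ω, b ω ≤ 1) :
    Integrable (fun ω => h ω * S ω ^ (1 / p) * b ω) μ ∧
    ∫ ω, h ω * S ω ^ (1 / p) * b ω ∂μ ≤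
      K ^ (1 / p) * √(∫ ω, h ω ^ 2 ∂μ) * (∫ ω, b ω ^ 2 ∂μ) ^ (1 / (p / (p - 1))) := by
  have hp0 : 0 < p := by linarith
  have hpq : p.HolderConjugate (p / (p - 1)) := Real.HolderConjugate.conjExponent hp1
  have hhm : Measurable h := hh.mono hm le_rfl
  have hq2 : 2 ≤ p / (p - 1) := by
    rw [le_div_iff₀ (by linarith)]; linarith
  have hφp : ∀ ω, (h ω * S ω ^ (1 / p)) ^ p = h ω ^ p * S ω := fun ω => by
    rw [Real.mul_rpow (hh0 ω) (Real.rpow_nonneg (hS0 ω) _), ← Real.rpow_mul (hS0 ω),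
      one_div_mul_cancel hp0.ne', Real.rpow_one]
  have hφ0 : ∀ ω, 0 ≤ h ω * S ω ^ (1 / p) := fun ω =>
    mul_nonneg (hh0 ω) (Real.rpow_nonneg (hS0 ω) _)
  have hhp0 : ∀ ω, 0 ≤ h ω ^ p := fun ω => Real.rpow_nonneg (hh0 ω) _
  have hhp1 : ∀ ω, h ω ^ p ≤ 1 := fun ω => Real.rpow_le_one (hh0 ω) (hh1 ω) hp0.le
  have hhpm : Measurable[m] fun ω => h ω ^ p := hh.pow_const p
  have hhpint : Integrable (fun ω => h ω ^ p) μ :=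
    integrable_of_measurable_of_mem_Icc (hhm.pow_const p) hhp0 hhp1
  have hφm : Measurable fun ω => h ω * S ω ^ (1 / p) := hhm.mul (hS.pow_const _)
  have hφmem : MemLp (fun ω => h ω * S ω ^ (1 / p)) (ENNReal.ofReal p) μ := by
    rw [← integrable_norm_rpow_iff hφm.aestronglyMeasurable
      (by simpa using hp0) ENNReal.ofReal_ne_top, ENNReal.toReal_ofReal hp0.le]
    refine hSint.mono (hφm.norm.pow_const p).aestronglyMeasurable (.of_forall fun ω => ?_)
    rw [Real.norm_of_nonneg (hφ0 ω), hφp, norm_mul, Real.norm_of_nonneg (hhp0 ω)]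
    exact mul_le_of_le_one_left (norm_nonneg _) (hhp1 ω)
  have hbmem : ∀ r, MemLp b r μ := fun r =>
    MemLp.of_bound hb.aestronglyMeasurable 1
      (.of_forall fun ω => by rw [Real.norm_of_nonneg (hb0 ω)]; exact hb1 ω)
  have hholder := integral_mul_le_Lp_mul_Lq_of_nonneg hpq (.of_forall hφ0) (.of_forall hb0)
    hφmem (hbmem _)
  have hsq : ∀ ω, h ω ^ p = (h ω ^ 2) ^ (p / 2) := fun ω => by
    rw [← Real.rpow_natCast, ← Real.rpow_mul (hh0 ω)]
    congr 1; push_cast; ring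
  have hh2 : Integrable (fun ω => h ω ^ 2) μ :=
    integrable_of_measurable_of_mem_Icc (hhm.pow_const 2) (fun ω => by positivity)
      fun ω => pow_le_one₀ (hh0 ω) (hh1 ω)
  have hjensen : ∫ ω, h ω ^ p ∂μ ≤ (∫ ω, h ω ^ 2 ∂μ) ^ (p / 2) := by
    have hconc : ConcaveOn ℝ (Set.Ici 0) fun y : ℝ => y ^ (p / 2) :=
      Real.concaveOn_rpow (by linarith) (by linarith)
    simp only [hsq] at hhpint ⊢
    exact hconc.le_map_integral
      (Real.continuous_rpow_const (by linarith)).continuousOn isClosed_Ici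
      (.of_forall fun ω => sq_nonneg (h ω)) hh2 hhpint
  have hI2 : 0 ≤ ∫ ω, h ω ^ 2 ∂μ := integral_nonneg fun ω => sq_nonneg _
  have hφint : ∫ ω, (h ω * S ω ^ (1 / p)) ^ p ∂μ ≤ K * (∫ ω, h ω ^ 2 ∂μ) ^ (p / 2) := by
    simp only [hφp]
    have habs : ∀ ω, |h ω ^ p| ≤ 1 := fun ω => by rw [abs_of_nonneg (hhp0 ω)]; exact hhp1 ω
    rw [integral_mul_condExp_of_bound hm hhpm habs hSint]
    calc ∫ ω, h ω ^ p * (μ[S | m]) ω ∂μ ≤ ∫ ω, K * h ω ^ p ∂μ := by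
          refine integral_mono_ae ?_ (hhpint.const_mul K) ?_
          · exact integrable_condExp.bdd_mul (c := 1) (hhm.pow_const p).aestronglyMeasurable
              (.of_forall habs)
          · filter_upwards [hSK] with ω hω
            rw [mul_comm K]
            exact mul_le_mul_of_nonneg_left hω (hhp0 ω)
      _ = K * ∫ ω, h ω ^ p ∂μ := integral_const_mul _ _
      _ ≤ _ := mul_le_mul_of_nonneg_left hjensen hK
  have hbint : ∫ ω, b ω ^ (p / (p - 1)) ∂μ ≤ ∫ ω, b ω ^ 2 ∂μ := by
    refine integral_mono ?_ ?_ fun ω => ?_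
    · exact integrable_of_measurable_of_mem_Icc (hb.pow_const _)
        (fun ω => Real.rpow_nonneg (hb0 ω) _)
        fun ω => Real.rpow_le_one (hb0 ω) (hb1 ω) (by linarith)
    · exact integrable_of_measurable_of_mem_Icc (hb.pow_const _) (fun ω => by positivity)
        fun ω => pow_le_one₀ (hb0 ω) (hb1 ω)
    · simp only
      rw [← Real.rpow_natCast]
      exact Real.rpow_le_rpow_of_exponent_ge_of_imp (hb0 ω) (hb1 ω) (by exact_mod_cast hq2)
        (by intro _ h0; linarith)
  have hroot : (K * (∫ ω, h ω ^ 2 ∂μ) ^ (p / 2)) ^ (1 / p) =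
      K ^ (1 / p) * √(∫ ω, h ω ^ 2 ∂μ) := by
    rw [Real.mul_rpow hK (Real.rpow_nonneg hI2 _), ← Real.rpow_mul hI2, Real.sqrt_eq_rpow]
    congr 2; field_simp
  have hq0 : 0 < p / (p - 1) := by linarith
  have hφi0 : 0 ≤ ∫ ω, (h ω * S ω ^ (1 / p)) ^ p ∂μ :=
    integral_nonneg fun ω => Real.rpow_nonneg (hφ0 ω) _
  have hbi0 : 0 ≤ ∫ ω, b ω ^ (p / (p - 1)) ∂μ :=
    integral_nonneg fun ω => Real.rpow_nonneg (hb0 ω) _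
  refine ⟨?_, hholder.trans ?_⟩
  · have := hφmem.integrable (by simpa using ENNReal.ofReal_le_ofReal hp1.le)
    exact this.mul_bdd (c := 1) hb.aestronglyMeasurable
      (.of_forall fun ω => by rw [Real.norm_of_nonneg (hb0 ω)]; exact hb1 ω)
  · rw [← hroot]
    gcongr

lemma norm_div_le_one {E : Type*} [NormedAddCommGroup E] (y : E) {r l : ℝ} (hl : 0 ≤ l)
    (hr : ‖y‖ ^ 2 ≤ r) : ‖y‖ / (l + √r) ≤ 1 :=
  div_le_one_of_le₀ ((Real.le_sqrt_of_sq_le hr).trans (by linarith)) (by positivity)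

lemma sq_norm_div_add_sqrt_le {E : Type*} [NormedAddCommGroup E] (y : E) {V l : ℝ}
    (hV : 0 ≤ V) (hl : 0 < l) :
    (‖y‖ / (l + √(V + ‖y‖ ^ 2))) ^ 2 ≤ ‖y‖ ^ 2 / (l ^ 2 + (V + ‖y‖ ^ 2)) := by
  have hsq := Real.sq_sqrt (add_nonneg hV (sq_nonneg ‖y‖))
  have hs := Real.sqrt_nonneg (V + ‖y‖ ^ 2)
  rw [div_pow]
  exact div_le_div_of_nonneg_left (sq_nonneg _) (by positivity) (by nlinarith)

lemma integrable_norm_sq_div_add {E : Type*} [NormedAddCommGroup E] [MeasurableSpace E]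
    [OpensMeasurableSpace E] {g : Ω → E} {V : Ω → ℝ} {l : ℝ} (hl : 0 < l)
    (hg : Measurable g) (hV : Measurable V) (hV0 : ∀ ω, 0 ≤ V ω) :
    Integrable (fun ω => ‖g ω‖ ^ 2 / (l ^ 2 + (V ω + ‖g ω‖ ^ 2))) μ := by
  refine integrable_of_measurable_of_mem_Icc (by fun_prop)
    (fun ω => by have := hV0 ω; positivity) fun ω => ?_
  exact div_le_one_of_le₀ (by have := hV0 ω; nlinarith) (by have := hV0 ω; positivity)

/-- One step of progress with the proxy stepsize, relative to a sub-σ-algebra `m` for which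
`G` is the conditional mean of `g`. -/
lemma integral_norm_sq_div_proxy_le {d : ℕ} (hm : m ≤ m0)
    {G g : Ω → EuclideanSpace ℝ (Fin d)} {V : Ω → ℝ} {l c p : ℝ} {σ : Fin d → ℝ}
    (hl : 0 < l) (hc : 0 < c) (hp1 : 1 < p) (hp2 : p ≤ 2) (hσ : ∀ i, 0 ≤ σ i)
    (hG : Measurable[m] G) (hV : Measurable[m] V) (hV0 : ∀ ω, 0 ≤ V ω)
    (hg : Measurable g) (hgint : Integrable g μ)
    (hunbiased : ∀ i, μ[(fun ω => g ω i) | m] =ᵐ[μ] fun ω => G ω i)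
    (hnoiseint : ∀ i, Integrable (fun ω => |g ω i - G ω i| ^ p) μ)
    (hnoise : ∀ i, ∀ᵐ ω ∂μ, (μ[(fun ω' => |g ω' i - G ω' i| ^ p) | m]) ω ≤ σ i ^ p) :
    Integrable (fun ω => inner ℝ (G ω) (g ω) / (l + √(V ω + ‖g ω‖ ^ 2))) μ ∧
    1 / 2 * ∫ ω, ‖G ω‖ ^ 2 / (l + √(V ω + ‖G ω‖ ^ 2 + c ^ 2)) ∂μ ≤
      ∫ ω, inner ℝ (G ω) (g ω) / (l + √(V ω + ‖g ω‖ ^ 2)) ∂μ +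
      ((∑ i, σ i ^ p) ^ (1 / p)) ^ 2 / c *
        (∫ ω, ‖g ω‖ ^ 2 / (l ^ 2 + (V ω + ‖g ω‖ ^ 2)) ∂μ) ^ (2 / (p / (p - 1))) +
      c * ∫ ω, ‖g ω‖ ^ 2 / (l ^ 2 + (V ω + ‖g ω‖ ^ 2)) ∂μ := by
  have hGm : Measurable G := hG.mono hm le_rfl
  have hVm : Measurable V := hV.mono hm le_rfl
  set W : Ω → ℝ := fun ω => l + √(V ω + ‖G ω‖ ^ 2 + c ^ 2) with hWdef
  set D : Ω → ℝ := fun ω => l + √(V ω + ‖g ω‖ ^ 2) with hDdef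
  set A : Ω → ℝ := fun ω => ‖g ω‖ ^ 2 / (l ^ 2 + (V ω + ‖g ω‖ ^ 2))
  have hWmeas : Measurable[m] W := by
    have hn : Measurable[m] fun ω => ‖G ω‖ := measurable_norm.comp hG
    exact (((hV.add (hn.pow_const 2)).add_const _).sqrt).const_add l
  have hWm : Measurable W := hWmeas.mono hm le_rfl
  have hDm : Measurable D := by fun_prop
  have hWpos : ∀ ω, 0 < W ω := fun ω => by positivity
  have hDpos : ∀ ω, 0 < D ω := fun ω => by positivity
  have hcW : ∀ ω, c ≤ W ω := fun ω => by
    have : c ≤ √(V ω + ‖G ω‖ ^ 2 + c ^ 2) :=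
      Real.le_sqrt_of_sq_le (by have := hV0 ω; nlinarith [sq_nonneg ‖G ω‖])
    simp only [hWdef]; linarith
  have hh1 : ∀ ω, ‖G ω‖ / W ω ≤ 1 := fun ω =>
    norm_div_le_one _ hl.le (by have := hV0 ω; nlinarith)
  have hb1 : ∀ ω, ‖g ω‖ / D ω ≤ 1 := fun ω =>
    norm_div_le_one _ hl.le (by have := hV0 ω; linarith)
  have hh0 : ∀ ω, 0 ≤ ‖G ω‖ / W ω := fun ω => div_nonneg (norm_nonneg _) (hWpos ω).le
  have hb0 : ∀ ω, 0 ≤ ‖g ω‖ / D ω := fun ω => div_nonneg (norm_nonneg _) (hDpos ω).le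
  have hbA : ∀ ω, (‖g ω‖ / D ω) ^ 2 ≤ A ω := fun ω =>
    sq_norm_div_add_sqrt_le (g ω) (hV0 ω) hl
  have hA0 : ∀ ω, 0 ≤ A ω := fun ω => (sq_nonneg _).trans (hbA ω)
  have hAint : Integrable A μ := integrable_norm_sq_div_add hl hg hVm hV0
  have hGi : ∀ i, Integrable (fun ω => G ω i) μ := fun i =>
    integrable_condExp.congr (hunbiased i)
  have hgi : ∀ i, Integrable (fun ω => g ω i) μ := fun i =>
    (EuclideanSpace.proj (𝕜 := ℝ) i).integrable_comp hgint
  have hGint : Integrable (fun ω => ‖G ω‖) μ := by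
    refine (integrable_finsetSum univ fun i _ => (hGi i).abs).mono'
      hGm.norm.aestronglyMeasurable (.of_forall fun ω => ?_)
    simpa using norm_rpow_le_sum_abs_rpow one_pos one_le_two (G ω)
  have hQint : Integrable (fun ω => ‖G ω‖ ^ 2 / W ω) μ := by
    refine hGint.mono' ((hGm.norm.pow_const 2).div hWm).aestronglyMeasurable (.of_forall fun ω => ?_)
    rw [Real.norm_of_nonneg (div_nonneg (sq_nonneg _) (hWpos ω).le)]
    calc ‖G ω‖ ^ 2 / W ω = ‖G ω‖ * (‖G ω‖ / W ω) := by ring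
      _ ≤ ‖G ω‖ := mul_le_of_le_one_right (norm_nonneg _) (hh1 ω)
  have hinnerD : Integrable (fun ω => inner ℝ (G ω) (g ω) / D ω) μ := by
    refine hGint.mono' ((hGm.inner hg).div hDm).aestronglyMeasurable (.of_forall fun ω => ?_)
    rw [norm_div, Real.norm_of_nonneg (hDpos ω).le]
    calc ‖inner ℝ (G ω) (g ω)‖ / D ω ≤ ‖G ω‖ * ‖g ω‖ / D ω :=
          div_le_div_of_nonneg_right (norm_inner_le_norm _ _) (hDpos ω).le
      _ = ‖G ω‖ * (‖g ω‖ / D ω) := by ring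
      _ ≤ ‖G ω‖ := mul_le_of_le_one_right (norm_nonneg _) (hb1 ω)
  have hcoordm : ∀ i, Measurable[m] fun ω => G ω i / W ω := fun i =>
    ((EuclideanSpace.proj (𝕜 := ℝ) i).measurable.comp hG).div hWmeas
  have hcoord1 : ∀ i ω, |G ω i / W ω| ≤ 1 := fun i ω => by
    rw [abs_div, abs_of_pos (hWpos ω)]
    exact (div_le_div_of_nonneg_right (PiLp.norm_apply_le (G ω) i) (hWpos ω).le).trans (hh1 ω)
  have hcoordint : ∀ i {Y : Ω → ℝ}, Integrable Y μ → Integrable (fun ω => G ω i / W ω * Y ω) μ :=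
    fun i Y hY => hY.bdd_mul (c := 1) ((hcoordm i).mono hm le_rfl).aestronglyMeasurable
      (.of_forall (hcoord1 i))
  have hinner_eq : ∀ ω, inner ℝ (G ω) (g ω) / W ω = ∑ i, G ω i / W ω * g ω i := fun ω => by
    rw [PiLp.inner_apply, sum_div]
    exact sum_congr rfl fun i _ => by simp; ring
  have hsq_eq : ∀ ω, ‖G ω‖ ^ 2 / W ω = ∑ i, G ω i / W ω * G ω i := fun ω => by
    rw [EuclideanSpace.real_norm_sq_eq, sum_div]
    exact sum_congr rfl fun i _ => by ring
  have hinnerW : Integrable (fun ω => inner ℝ (G ω) (g ω) / W ω) μ := by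
    simp only [hinner_eq]
    exact integrable_finsetSum _ fun i _ => hcoordint i (hgi i)
  have hswap : ∫ ω, ‖G ω‖ ^ 2 / W ω ∂μ = ∫ ω, inner ℝ (G ω) (g ω) / W ω ∂μ := by
    simp only [hinner_eq, hsq_eq]
    rw [integral_finsetSum _ fun i _ => hcoordint i (hGi i),
      integral_finsetSum _ fun i _ => hcoordint i (hgi i)]
    refine sum_congr rfl fun i _ => ?_
    rw [integral_mul_condExp_of_bound hm (hcoordm i) (hcoord1 i) (hgi i)]
    refine integral_congr_ae ?_
    filter_upwards [hunbiased i] with ω hω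
    rw [hω]
  set S : Ω → ℝ := fun ω => ∑ i, |g ω i - G ω i| ^ p with hSdef
  set K : ℝ := ∑ i, σ i ^ p
  have hK : 0 ≤ K := sum_nonneg fun i _ => Real.rpow_nonneg (hσ i) _
  have hS0 : ∀ ω, 0 ≤ S ω := fun ω => by positivity
  have hSK : ∀ᵐ ω ∂μ, (μ[S | m]) ω ≤ K := by
    have hsum := condExp_finsetSum (s := univ) (fun i _ => hnoiseint i) m
    have hSsum : S = ∑ i, fun ω => |g ω i - G ω i| ^ p := by
      ext ω; simp [hSdef]
    rw [← hSsum] at hsum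
    filter_upwards [hsum, ae_all_iff.2 hnoise] with ω h1 h2
    rw [h1, Finset.sum_apply]
    exact sum_le_sum fun i _ => h2 i
  have hSm : Measurable S := by fun_prop
  have hhm : Measurable[m] fun ω => ‖G ω‖ / W ω := (measurable_norm.comp hG).div hWmeas
  obtain ⟨hNint, hN⟩ := integral_mul_rpow_mul_le (μ := μ) hm hp1 hp2 hhm hh0 hh1 hSm
    (integrable_finsetSum _ fun i _ => hnoiseint i) hS0 hK hSK
    (by fun_prop : Measurable fun ω => ‖g ω‖ / D ω) hb0 hb1
  have hch : ∀ ω, c * (‖G ω‖ / W ω) ^ 2 ≤ ‖G ω‖ ^ 2 / W ω := fun ω => by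
    calc c * (‖G ω‖ / W ω) ^ 2 ≤ W ω * (‖G ω‖ / W ω) ^ 2 := by gcongr; exact hcW ω
      _ = _ := by have := (hWpos ω).ne'; field_simp
  have hpoint : ∀ ω, inner ℝ (G ω) (g ω) / W ω ≤ inner ℝ (G ω) (g ω) / D ω +
      ‖G ω‖ / W ω * S ω ^ (1 / p) * (‖g ω‖ / D ω) +
      (1 / 4 * (‖G ω‖ ^ 2 / W ω) + c * A ω) := fun ω => by
    have hkey := inner_div_proxy_sub_le (G ω) (g ω) (hV0 ω) hc.le hl
    have hn : ‖g ω - G ω‖ ≤ S ω ^ (1 / p) := by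
      have := norm_rpow_le_sum_abs_rpow (by linarith) hp2 (g ω - G ω)
      rw [one_div, Real.le_rpow_inv_iff_of_pos (norm_nonneg _) (hS0 ω) (by linarith)]
      simpa [hSdef] using this
    have hnoise_le : ‖G ω‖ / W ω * ‖g ω - G ω‖ * (‖g ω‖ / D ω) ≤
        ‖G ω‖ / W ω * S ω ^ (1 / p) * (‖g ω‖ / D ω) :=
      mul_le_mul_of_nonneg_right (mul_le_mul_of_nonneg_left hn (hh0 ω)) (hb0 ω)
    have hyoung : c * (‖G ω‖ / W ω * (‖g ω‖ / D ω)) ≤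
        1 / 4 * (‖G ω‖ ^ 2 / W ω) + c * A ω := by
      nlinarith [mul_nonneg hc.le (sq_nonneg (‖G ω‖ / W ω / 2 - ‖g ω‖ / D ω)),
        mul_le_mul_of_nonneg_left (hbA ω) hc.le, hch ω]
    linarith
  have hmain : ∫ ω, inner ℝ (G ω) (g ω) / W ω ∂μ ≤ ∫ ω, inner ℝ (G ω) (g ω) / D ω ∂μ +
      ∫ ω, ‖G ω‖ / W ω * S ω ^ (1 / p) * (‖g ω‖ / D ω) ∂μ +
      (1 / 4 * ∫ ω, ‖G ω‖ ^ 2 / W ω ∂μ + c * ∫ ω, A ω ∂μ) := by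
    rw [← integral_const_mul, ← integral_const_mul,
      ← integral_add (hQint.const_mul _) (hAint.const_mul _), ← integral_add hinnerD hNint,
      ← integral_add (hinnerD.fun_add hNint) ((hQint.const_mul _).fun_add (hAint.const_mul _))]
    exact integral_mono hinnerW
      ((hinnerD.add hNint).add ((hQint.const_mul _).add (hAint.const_mul _))) hpoint
  have hch_int : c * ∫ ω, (‖G ω‖ / W ω) ^ 2 ∂μ ≤ ∫ ω, ‖G ω‖ ^ 2 / W ω ∂μ := by
    rw [← integral_const_mul]
    exact integral_mono_of_nonneg (.of_forall fun ω => by positivity) hQint (.of_forall hch)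
  have hbA_int : ∫ ω, (‖g ω‖ / D ω) ^ 2 ∂μ ≤ ∫ ω, A ω ∂μ :=
    integral_mono_of_nonneg (.of_forall fun ω => sq_nonneg _) hAint (.of_forall hbA)
  have hq : 0 < p / (p - 1) := div_pos (by linarith) (by linarith)
  have hIA : 0 ≤ ∫ ω, A ω ∂μ := integral_nonneg hA0
  have hpow : (∫ ω, A ω ∂μ) ^ (2 / (p / (p - 1))) =
      ((∫ ω, A ω ∂μ) ^ (1 / (p / (p - 1)))) ^ 2 := by
    rw [← Real.rpow_natCast, ← Real.rpow_mul hIA]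
    congr 1; push_cast; ring
  have hN' : ∫ ω, ‖G ω‖ / W ω * S ω ^ (1 / p) * (‖g ω‖ / D ω) ∂μ ≤
      K ^ (1 / p) * √(∫ ω, (‖G ω‖ / W ω) ^ 2 ∂μ) *
        (∫ ω, A ω ∂μ) ^ (1 / (p / (p - 1))) := by
    have hB0 : 0 ≤ ∫ ω, (‖g ω‖ / D ω) ^ 2 ∂μ := integral_nonneg fun ω => sq_nonneg _
    refine hN.trans ?_
    gcongr
  have hs := Real.sq_sqrt (integral_nonneg fun ω => sq_nonneg (‖G ω‖ / W ω) :
    0 ≤ ∫ ω, (‖G ω‖ / W ω) ^ 2 ∂μ)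
  refine ⟨hinnerD, ?_⟩
  rw [hpow]
  generalize √(∫ ω, (‖G ω‖ / W ω) ^ 2 ∂μ) = s at hN' hs
  generalize (∫ ω, A ω ∂μ) ^ (1 / (p / (p - 1))) = β at hN' ⊢
  generalize K ^ (1 / p) = k at hN' ⊢
  have hyoung : k * s * β ≤ 1 / 4 * (c * s ^ 2) + k ^ 2 / c * β ^ 2 := by
    have : 1 / 4 * (c * s ^ 2) + k ^ 2 / c * β ^ 2 - k * s * β =
        (c * s / 2 - k * β) ^ 2 / c := by field_simp; ring
    have h0 : 0 ≤ (c * s / 2 - k * β) ^ 2 / c := by positivity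
    linarith
  rw [hs] at hyoung
  linarith

end CondExp

lemma adaNormV_nonneg {Ω : Type} {d : ℕ} {g : ℕ → Ω → EuclideanSpace ℝ (Fin d)}
    (t : ℕ) (ω : Ω) : 0 ≤ adaNormV g t ω :=
  Finset.sum_nonneg fun _ _ => sq_nonneg _

lemma adaNormV_succ {Ω : Type} {d : ℕ} {g : ℕ → Ω → EuclideanSpace ℝ (Fin d)}
    (t : ℕ) (ω : Ω) :
    adaNormV g (t + 1) ω = adaNormV g t ω + ‖g (t + 1) ω‖ ^ 2 :=
  Finset.sum_Icc_succ_top (by omega) _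

section Iterates

variable {Ω : Type} [MeasurableSpace Ω] {d : ℕ} {g : ℕ → Ω → EuclideanSpace ℝ (Fin d)}

lemma natFilt_le (hg : ∀ t, Measurable (g t)) (t : ℕ) : natFilt g t ≤ ‹MeasurableSpace Ω› :=
  iSup₂_le fun s _ => (hg s).comap_le

lemma natFilt_mono {s t : ℕ} (hst : s ≤ t) : natFilt g s ≤ natFilt g t :=
  biSup_mono fun _ hr => Finset.Icc_subset_Icc_right hst hr

lemma measurable_natFilt {s t : ℕ} (hs : 1 ≤ s) (hst : s ≤ t) :
    Measurable[natFilt g t] (g s) :=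
  (comap_measurable (g s)).mono
    (le_iSup₂_of_le (f := fun s _ => MeasurableSpace.comap (g s) inferInstance) s
      (Finset.mem_Icc.2 ⟨hs, hst⟩) le_rfl) le_rfl

lemma measurable_adaNormV (t : ℕ) : Measurable[natFilt g t] (adaNormV g t) := by
  refine Finset.measurable_fun_sum _ fun s hs => ?_
  obtain ⟨h1, h2⟩ := Finset.mem_Icc.1 hs
  exact (measurable_norm.comp (measurable_natFilt h1 h2)).pow_const 2

lemma measurable_iterate {x : ℕ → Ω → EuclideanSpace ℝ (Fin d)}
    {x₁ : EuclideanSpace ℝ (Fin d)} {γ lam : ℝ} (hx1 : ∀ ω, x 1 ω = x₁)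
    (hxupd : ∀ t, 1 ≤ t → ∀ ω,
      x (t + 1) ω = x t ω - (γ / (lam + √(adaNormV g t ω))) • g t ω) (t : ℕ) :
    Measurable[natFilt g t] (x (t + 1)) := by
  induction t with
  | zero =>
    rw [show x (0 + 1) = fun _ => x₁ from funext hx1]
    exact measurable_const
  | succ k ih =>
    rw [funext (hxupd (k + 1) (by omega))]
    have hstep : Measurable[natFilt g (k + 1)]
        fun ω => γ / (lam + √(adaNormV g (k + 1) ω)) :=
      ((measurable_adaNormV (k + 1)).sqrt.const_add lam).const_div γ
    exact (ih.mono (natFilt_mono k.le_succ) le_rfl).sub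
      (hstep.smul (measurable_natFilt (by omega) le_rfl))

end Iterates

lemma measurable_of_hasGradientAt {E : Type*} [NormedAddCommGroup E] [InnerProductSpace ℝ E]
    [CompleteSpace E] [MeasurableSpace E] [BorelSpace E] {f : E → ℝ} {f' : E → E}
    (hf : ∀ y, HasGradientAt f (f' y) y) : Measurable f' := by
  have hf' : f' = fun y => (InnerProductSpace.toDual ℝ E).symm (fderiv ℝ f y) :=
    funext fun y => (hf y).gradient.symm
  rw [hf']
  exact (InnerProductSpace.toDual ℝ E).symm.continuous.measurable.comp (measurable_fderiv ℝ f)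

/-- The descent lemma under coordinate-wise smoothness for a step `-s • g`. -/
lemma mul_inner_le_sub_of_smooth {d : ℕ} {f : EuclideanSpace ℝ (Fin d) → ℝ}
    {gradf : EuclideanSpace ℝ (Fin d) → EuclideanSpace ℝ (Fin d)} {L : Fin d → ℝ}
    (hsmooth : ∀ u v : EuclideanSpace ℝ (Fin d),
      |f u - f v - ∑ i, gradf v i * (u i - v i)| ≤ 1 / 2 * ∑ i, L i * (u i - v i) ^ 2)
    (y g : EuclideanSpace ℝ (Fin d)) (s : ℝ) :
    s * inner ℝ (gradf y) g ≤ f y - f (y - s • g) + (⨆ j, L j) / 2 * (s ^ 2 * ‖g‖ ^ 2) := by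
  have h := (abs_le.1 (hsmooth (y - s • g) y)).2
  have hlin : ∑ i, gradf y i * ((y - s • g) i - y i) = -(s * inner ℝ (gradf y) g) := by
    rw [PiLp.inner_apply, mul_sum, ← sum_neg_distrib]
    exact sum_congr rfl fun i _ => by simp; ring
  have hquad : ∑ i, L i * ((y - s • g) i - y i) ^ 2 ≤ (⨆ j, L j) * (s ^ 2 * ‖g‖ ^ 2) := by
    rw [EuclideanSpace.real_norm_sq_eq, mul_sum, mul_sum]
    refine sum_le_sum fun i _ => ?_
    have hi : L i ≤ ⨆ j, L j := le_ciSup (Set.finite_range L).bddAbove i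
    calc L i * ((y - s • g) i - y i) ^ 2 = L i * (s ^ 2 * g i ^ 2) := by
          simp [mul_pow]
      _ ≤ _ := mul_le_mul_of_nonneg_right hi (by positivity)
  rw [hlin] at h
  linarith

/-- the per-iteration progress inequality for AdaGrad-Norm with
the proxy stepsize `w_t = v_{t−1} + ‖∇f(x_t)‖₂² + c²`.  Under (A2)–(A4), for
any scalar `c > 0` and any `t ≥ 1`,
`(γ/2)·E[‖∇f(x_t)‖₂²/(λ + √w_t)]
  ≤ E[f(x_t) − f(x_{t+1})]
    + γ (‖σ‖_p²/c)·(E[‖g_t‖₂²/(λ² + v_t)])^{2/p̄}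
    + γ (c + γ‖L‖_∞/2)·E[‖g_t‖₂²/(λ² + v_t)]`, where `p̄ = p/(p−1)`. -/
theorem adagradNorm_core_inequality
    (d : ℕ) (Ω : Type) [MeasurableSpace Ω] (μ : Measure Ω) [IsProbabilityMeasure μ]
    (f : EuclideanSpace ℝ (Fin d) → ℝ)
    (gradf : EuclideanSpace ℝ (Fin d) → EuclideanSpace ℝ (Fin d))
    (g x : ℕ → Ω → EuclideanSpace ℝ (Fin d)) (x₁ : EuclideanSpace ℝ (Fin d))
    (γ lam p : ℝ) (L σ : Fin d → ℝ)
    (hγ : 0 < γ) (hlam : 0 < lam)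
    (hgrad : ∀ y, HasGradientAt f (gradf y) y)
    (hL : ∀ i, 0 < L i)
    (hsmooth : ∀ u v : EuclideanSpace ℝ (Fin d),
      |f u - f v - ∑ i, gradf v i * (u i - v i)| ≤ 1 / 2 * ∑ i, L i * (u i - v i) ^ 2)
    (hgmeas : ∀ t, Measurable (g t))
    (hgint : ∀ t, Integrable (g t) μ)
    (hfint : ∀ t, Integrable (fun ω => f (x t ω)) μ)
    (hx1 : ∀ ω, x 1 ω = x₁)
    (hxupd : ∀ t, 1 ≤ t → ∀ ω,
      x (t + 1) ω = x t ω - (γ / (lam + Real.sqrt (adaNormV g t ω))) • g t ω)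
    (hunbiased : ∀ t, 1 ≤ t → ∀ i : Fin d,
      μ[(fun ω => g t ω i) | natFilt g (t - 1)] =ᵐ[μ] fun ω => gradf (x t ω) i)
    (hp1 : 1 < p) (hp2 : p ≤ 2) (hσ : ∀ i, 0 ≤ σ i)
    (hnoise : ∀ t, 1 ≤ t → ∀ i : Fin d,
      Integrable (fun ω => |g t ω i - gradf (x t ω) i| ^ p) μ ∧
      ∀ᵐ ω ∂μ,
        (μ[(fun ω' => |g t ω' i - gradf (x t ω') i| ^ p) | natFilt g (t - 1)]) ω ≤ σ i ^ p)
    (c : ℝ) (hc : 0 < c) (t : ℕ) (ht : 1 ≤ t) :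
    γ / 2 * ∫ ω, ‖gradf (x t ω)‖ ^ 2 /
        (lam + Real.sqrt (adaNormV g (t - 1) ω + ‖gradf (x t ω)‖ ^ 2 + c ^ 2)) ∂μ ≤
      (∫ ω, (f (x t ω) - f (x (t + 1) ω)) ∂μ) +
      γ * (((∑ i, σ i ^ p) ^ (1 / p)) ^ 2 / c) *
        (∫ ω, ‖g t ω‖ ^ 2 / (lam ^ 2 + adaNormV g t ω) ∂μ) ^ (2 / (p / (p - 1))) +
      γ * (c + γ * (⨆ j, L j) / 2) *
        ∫ ω, ‖g t ω‖ ^ 2 / (lam ^ 2 + adaNormV g t ω) ∂μ := by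
  obtain ⟨n, rfl⟩ : ∃ n, t = n + 1 := ⟨t - 1, by omega⟩
  simp only [Nat.add_sub_cancel] at *
  have hm := natFilt_le hgmeas n
  have hVm := measurable_adaNormV (g := g) n
  have hV0 := adaNormV_nonneg (g := g) n
  have hGm : Measurable[natFilt g n] fun ω => gradf (x (n + 1) ω) :=
    (measurable_of_hasGradientAt hgrad).comp (measurable_iterate hx1 hxupd n)
  obtain ⟨hinner, hmain⟩ := integral_norm_sq_div_proxy_le (μ := μ) hm hlam hc hp1 hp2 hσ hGm
    hVm hV0 (hgmeas (n + 1)) (hgint (n + 1)) (hunbiased (n + 1) ht)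
    (fun i => (hnoise (n + 1) ht i).1) fun i => (hnoise (n + 1) ht i).2
  have hAint := integrable_norm_sq_div_add (μ := μ) hlam (hgmeas (n + 1))
    (hVm.mono hm le_rfl) hV0
  simp only [adaNormV_succ]
  have hL0 : 0 ≤ ⨆ j, L j := Real.iSup_nonneg fun j => (hL j).le
  have hdescent : γ * ∫ ω, inner ℝ (gradf (x (n + 1) ω)) (g (n + 1) ω) /
        (lam + √(adaNormV g n ω + ‖g (n + 1) ω‖ ^ 2)) ∂μ ≤
      ∫ ω, (f (x (n + 1) ω) - f (x (n + 1 + 1) ω)) ∂μ +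
      γ ^ 2 * (⨆ j, L j) / 2 *
        ∫ ω, ‖g (n + 1) ω‖ ^ 2 / (lam ^ 2 + (adaNormV g n ω + ‖g (n + 1) ω‖ ^ 2)) ∂μ := by
    have hfd : Integrable (fun ω => f (x (n + 1) ω) - f (x (n + 1 + 1) ω)) μ :=
      (hfint (n + 1)).sub (hfint (n + 1 + 1))
    rw [← integral_const_mul, ← integral_const_mul, ← integral_add hfd (hAint.const_mul _)]
    refine integral_mono (hinner.const_mul γ) (hfd.add (hAint.const_mul _)) fun ω => ?_
    have hstep := mul_inner_le_sub_of_smooth hsmooth (x (n + 1) ω) (g (n + 1) ω)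
      (γ / (lam + √(adaNormV g (n + 1) ω)))
    rw [← hxupd (n + 1) ht ω, adaNormV_succ] at hstep
    have hb := mul_le_mul_of_nonneg_left (sq_norm_div_add_sqrt_le (g (n + 1) ω) (hV0 ω) hlam)
      (by positivity : 0 ≤ γ ^ 2 * (⨆ j, L j) / 2)
    calc _ = γ / (lam + √(adaNormV g n ω + ‖g (n + 1) ω‖ ^ 2)) *
          inner ℝ (gradf (x (n + 1) ω)) (g (n + 1) ω) := by ring
      _ ≤ _ := hstep
      _ = f (x (n + 1) ω) - f (x (n + 1 + 1) ω) + γ ^ 2 * (⨆ j, L j) / 2 *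
          (‖g (n + 1) ω‖ / (lam + √(adaNormV g n ω + ‖g (n + 1) ω‖ ^ 2))) ^ 2 := by ring
      _ ≤ _ := by simpa using hb
  have hscaled := mul_le_mul_of_nonneg_left hmain hγ.le
  linarith
end

section
/- Let p ∈ (1,2], σ ≥ 0, ε > 0, and set q = [1 + ((p−1)/4)·(2σ/ε)^p]^{−1/(p−1)}. Then q ∈ (0,1], and if r is a Bernoulli(q) random variable (r = 1 with probability q, r = 0 with probability 1−q), the random variable ξ = (r/q − 1)·ε satisfies E[ξ] = 0 and E[|ξ|^p] = (1−q)·(q^{p−1} + (1−q)^{p−1})/q^{p−1} · ε^p ≤ σ^p. -/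
open MeasureTheory

/-- The expectation of a function of a Bernoulli random variable. -/
lemma integral_comp_of_zero_or_one {Ω : Type*} [MeasurableSpace Ω] {μ : Measure Ω}
    [IsProbabilityMeasure μ] {r : Ω → ℝ} (hr : Measurable r) (h01 : ∀ ω, r ω = 0 ∨ r ω = 1)
    {q : ℝ} (hq : 0 ≤ q) (hμ : μ {ω | r ω = 1} = ENNReal.ofReal q) (f : ℝ → ℝ) :
    ∫ ω, f (r ω) ∂μ = q * f 1 + (1 - q) * f 0 := by
  have hs : MeasurableSet {ω | r ω = 1} := hr (measurableSet_singleton 1)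
  have hf : (fun ω => f (r ω)) =
      fun ω => f 0 + {ω | r ω = 1}.indicator (fun _ => f 1 - f 0) ω := by
    funext ω
    rcases h01 ω with h | h <;> simp [h]
  rw [hf, integral_add (integrable_const _) ((integrable_const _).indicator hs),
    integral_indicator_const _ hs, measureReal_def, hμ, ENNReal.toReal_ofReal hq]
  simp
  ring

lemma rpow_add_one_sub_rpow_le {q s : ℝ} (hq0 : 0 ≤ q) (hq1 : q ≤ 1) (hs0 : 0 ≤ s)
    (hs1 : s ≤ 1) : q ^ s + (1 - q) ^ s ≤ 2 ^ (1 - s) := by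
  have h := (Real.concaveOn_rpow hs0 hs1).2 (Set.mem_Ici.2 hq0)
    (Set.mem_Ici.2 (sub_nonneg.2 hq1)) (show (0 : ℝ) ≤ 2⁻¹ by norm_num)
    (show (0 : ℝ) ≤ 2⁻¹ by norm_num) (by norm_num)
  have hmid : (2⁻¹ : ℝ) • q + (2⁻¹ : ℝ) • (1 - q) = 2⁻¹ := by
    simp only [smul_eq_mul]; ring
  rw [hmid] at h
  simp only [smul_eq_mul, Real.inv_rpow zero_le_two] at h
  rw [Real.rpow_sub two_pos, Real.rpow_one, div_eq_mul_inv]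
  linarith

lemma mul_one_sub_le_one_sub_rpow {q s : ℝ} (hq0 : 0 ≤ q) (hs0 : 0 ≤ s) (hs1 : s ≤ 1) :
    s * (1 - q) ≤ 1 - q ^ s := by
  have h := rpow_one_add_le_one_add_mul_self (s := q - 1) (by linarith) hs0 hs1
  rw [add_sub_cancel] at h
  linarith

/-- the multiplicative Bernoulli noise of the lower-bound
construction.  With `q = [1 + ((p−1)/4)(2σ/ε)^p]^{−1/(p−1)}` one has
`q ∈ (0,1]`, and for any Bernoulli(q) random variable `r` (valued in `{0,1}`,
with `P[r = 1] = q`) the noise `ξ = (r/q − 1)ε` has mean zero and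
`E[|ξ|^p] = (1−q)(q^{p−1} + (1−q)^{p−1})/q^{p−1} · ε^p ≤ σ^p`. -/
theorem bernoulli_noise_moment (p σ ε : ℝ) (hp1 : 1 < p) (hp2 : p ≤ 2)
    (hσ : 0 ≤ σ) (hε : 0 < ε) (q : ℝ)
    (hq : q = (1 + (p - 1) / 4 * (2 * σ / ε) ^ p) ^ (-(1 / (p - 1)))) :
    (0 < q ∧ q ≤ 1) ∧
    ∀ (Ω : Type) [MeasurableSpace Ω] (μ : Measure Ω) [IsProbabilityMeasure μ] (r : Ω → ℝ),
      Measurable r → (∀ ω, r ω = 0 ∨ r ω = 1) →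
      μ {ω | r ω = 1} = ENNReal.ofReal q →
      (∫ ω, (r ω / q - 1) * ε ∂μ) = 0 ∧
      (∫ ω, |(r ω / q - 1) * ε| ^ p ∂μ) =
        (1 - q) * (q ^ (p - 1) + (1 - q) ^ (p - 1)) / q ^ (p - 1) * ε ^ p ∧
      (1 - q) * (q ^ (p - 1) + (1 - q) ^ (p - 1)) / q ^ (p - 1) * ε ^ p ≤ σ ^ p := by
  have hs0 : 0 < p - 1 := sub_pos.2 hp1
  have hs1 : p - 1 ≤ 1 := by linarith
  have hbase : 1 ≤ 1 + (p - 1) / 4 * (2 * σ / ε) ^ p := by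
    have : 0 ≤ (p - 1) / 4 * (2 * σ / ε) ^ p := by positivity
    linarith
  have hq0 : 0 < q := hq ▸ Real.rpow_pos_of_pos (by linarith) _
  have hq1 : q ≤ 1 := by
    rw [hq]
    exact Real.rpow_le_one_of_one_le_of_nonpos hbase (neg_nonpos.2 (by positivity))
  have hqs : 0 < q ^ (p - 1) := Real.rpow_pos_of_pos hq0 _
  have h1q : 0 ≤ 1 - q := sub_nonneg.2 hq1
  have hrpow_succ : ∀ {x : ℝ}, 0 ≤ x → x ^ p = x ^ (p - 1) * x := fun {x} hx => by
    simpa using Real.rpow_add_one' hx (y := p - 1) (by linarith)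
  refine ⟨⟨hq0, hq1⟩, fun Ω _ μ _ r hr h01 hμ => ⟨?_, ?_, ?_⟩⟩
  · rw [integral_comp_of_zero_or_one hr h01 hq0.le hμ (fun x => (x / q - 1) * ε)]
    field_simp
    ring
  · rw [integral_comp_of_zero_or_one hr h01 hq0.le hμ (fun x => |(x / q - 1) * ε| ^ p)]
    have hone : |(1 / q - 1) * ε| = (1 - q) / q * ε := by
      rw [show 1 / q - 1 = (1 - q) / q by field_simp, abs_of_nonneg (by positivity)]
    have hzero : |(0 / q - 1) * ε| = ε := by
      simp [abs_of_pos hε]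
    simp only [hone, hzero]
    rw [Real.mul_rpow (by positivity) hε.le, Real.div_rpow h1q hq0.le, hrpow_succ hq0.le,
      hrpow_succ h1q]
    field_simp
    ring
  · have hinv : (q ^ (p - 1))⁻¹ = 1 + (p - 1) / 4 * (2 * σ / ε) ^ p := by
      rw [hq, ← Real.rpow_mul (by linarith), ← Real.rpow_neg (by linarith)]
      rw [show -(-(1 / (p - 1)) * (p - 1)) = 1 by field_simp, Real.rpow_one]
    have hσp : σ ^ p = (1 - q ^ (p - 1)) / (p - 1) * 2 ^ (1 - (p - 1)) / q ^ (p - 1) * ε ^ p := by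
      have htwo : (2 : ℝ) ^ (1 - (p - 1)) = 4 / 2 ^ p := by
        rw [show 1 - (p - 1) = 2 - p by ring, Real.rpow_sub two_pos]
        norm_num
      have hsub : (1 - q ^ (p - 1)) / q ^ (p - 1) = (p - 1) / 4 * (2 ^ p * σ ^ p / ε ^ p) := by
        rw [← Real.mul_rpow zero_le_two hσ, ← Real.div_rpow (by positivity) hε.le, sub_div,
          div_self hqs.ne', one_div, hinv]
        ring
      have hεp : 0 < ε ^ p := Real.rpow_pos_of_pos hε _
      have h2p : (0 : ℝ) < 2 ^ p := Real.rpow_pos_of_pos two_pos _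
      calc σ ^ p = (p - 1) / 4 * (2 ^ p * σ ^ p / ε ^ p) / (p - 1) * (4 / 2 ^ p) * ε ^ p := by
            field_simp
        _ = _ := by rw [← hsub, htwo]; ring
    rw [hσp]
    gcongr
    · exact div_nonneg (sub_nonneg.2 (Real.rpow_le_one hq0.le hq1 hs0.le)) hs0.le
    · rw [le_div_iff₀ hs0, mul_comm]
      exact mul_one_sub_le_one_sub_rpow hq0.le hs0.le hs1
    · exact rpow_add_one_sub_rpow_le hq0.le hq1 hs0.le hs1
end

section
/- For any Δ > 0, L > 0, and ε > 0, the infimum over γ > 0 of Δ²/γ² + γ²L²·ln²(γL/ε) is at least (ΔL/2)·ln(2ΔL/ε²); that is, for every γ > 0, Δ²/γ² + γ²L²·ln²(γL/ε) ≥ (ΔL/2)·ln(2ΔL/ε²). -/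
theorem Real.log_le_inv_add_mul_sq_log {A η : ℝ} (hA : 0 < A) (hη : 0 < η) :
    Real.log A ≤ 1 / η + η * Real.log (A * η) ^ 2 := by
  have hmul : Real.log (A * η) = Real.log A + Real.log η := Real.log_mul hA.ne' hη.ne'
  have hlog : Real.log (3 / 4 * (1 / η)) ≤ 3 / 4 * (1 / η) - 1 :=
    Real.log_le_sub_one_of_pos (by positivity)
  have hconst : Real.log (4 / 3) ≤ 4 / 3 - 1 := Real.log_le_sub_one_of_pos (by norm_num)
  have hinv : Real.log (3 / 4 * (1 / η)) = -Real.log (4 / 3) - Real.log η := by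
    rw [← Real.log_inv, ← Real.log_div (by norm_num) hη.ne']
    congr 1
    field_simp
  have hsq : 0 ≤ η * (Real.log (A * η) - 1 / (2 * η)) ^ 2 := by positivity
  have hexpand : η * (Real.log (A * η) - 1 / (2 * η)) ^ 2 =
      η * Real.log (A * η) ^ 2 - Real.log (A * η) + 1 / 4 * (1 / η) := by
    field_simp
    ring
  linarith

/-- For any `Δ > 0`, `L > 0`, `ε > 0` and every `γ > 0`,
`Δ²/γ² + γ²L²·ln²(γL/ε) ≥ (ΔL/2)·ln(2ΔL/ε²)`. -/
theorem lower_bound_learning_rate_refinement (Δ L ε : ℝ) (hΔ : 0 < Δ) (hL : 0 < L) (hε : 0 < ε) :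
    ∀ γ : ℝ, 0 < γ →
      Δ * L / 2 * Real.log (2 * Δ * L / ε ^ 2) ≤
        Δ ^ 2 / γ ^ 2 + γ ^ 2 * L ^ 2 * (Real.log (γ * L / ε)) ^ 2 := by
  intro γ hγ
  have hη : 0 < γ ^ 2 * L / (2 * Δ) := by positivity
  have hA : 0 < 2 * Δ * L / ε ^ 2 := by positivity
  have hkey := Real.log_le_inv_add_mul_sq_log hA hη
  have harg : 2 * Δ * L / ε ^ 2 * (γ ^ 2 * L / (2 * Δ)) = (γ * L / ε) ^ 2 := by
    field_simp
  rw [harg, Real.log_pow] at hkey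
  calc
    _ ≤ Δ * L / 2 * _ := mul_le_mul_of_nonneg_left hkey (by positivity)
    _ = _ := by
      push_cast
      field_simp
end
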